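/- Let F_q be a finite field, let p ∈ F_q[x] be a monic irreducible polynomial of degree k, let P be a k×k matrix over F_q whose minimal polynomial is p, and let n = ks with s ≥ 1. The (k,n)-spread code S = {rowsp(A_1 | ⋯ | A_s) : A_i ∈ F_q[P], (A_1, …, A_s) ≠ (0, …, 0)} has cardinality |S| = (q^n − 1)/(q^k − 1). -/

import Mathlib

open Polynomial Matrix in
/-- If the minimal polynomial of `P` is irreducible, then only the zero element of `F[P]`
annihilates a nonzero row vector. -/
theorem aeval_eq_zero_of_vecMul_eq_zero {F n : Type*} [Field F] [Fintype n] [DecidableEq n]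
    {P : Matrix n n F} (hirr : Irreducible (minpoly F P)) {v : n → F} (hv : v ≠ 0) {f : F[X]}
    (h : v ᵥ* aeval P f = 0) : aeval P f = 0 := by
  by_contra hf
  have hnd : ¬ minpoly F P ∣ f := fun ⟨g, hg⟩ => hf (by rw [hg]; simp)
  obtain ⟨a, b, hab⟩ := (hirr.coprime_iff_not_dvd).2 hnd
  have h1 : aeval P f * aeval P b = 1 := by
    have := congrArg (aeval P) hab
    rwa [map_add, map_mul, minpoly.aeval, mul_zero, zero_add, mul_comm, map_mul, map_one] at this
  apply hv
  rw [← vecMul_one v, ← h1, ← vecMul_vecMul, h, zero_vecMul]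

open Polynomial Matrix in
/-- If the minimal polynomial of a `k × k` matrix `P` is irreducible of degree `k`, then every
nonzero row vector generates the whole space under `F[P]`. -/
theorem exists_vecMul_aeval_eq {F : Type*} [Field F] {k : ℕ}
    {P : Matrix (Fin k) (Fin k) F} (hirr : Irreducible (minpoly F P))
    (hdeg : (minpoly F P).natDegree = k) {v : Fin k → F} (hv : v ≠ 0) (w : Fin k → F) :
    ∃ f : F[X], v ᵥ* aeval P f = w := by
  let φ : (Fin k → F) →ₗ[F] (Fin k → F) :=
    (Matrix.vecMulBilin F F v) ∘ₗ (aeval P).toLinearMap ∘ₗ (degreeLT F k).subtype ∘ₗ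
      (degreeLTEquiv F k).symm.toLinearMap
  have hinj : Function.Injective φ := by
    rw [← LinearMap.ker_eq_bot, LinearMap.ker_eq_bot']
    intro c hc
    have h0 := aeval_eq_zero_of_vecMul_eq_zero hirr hv
      (f := ((degreeLTEquiv F k).symm c : F[X])) hc
    have hlt := mem_degreeLT.1 ((degreeLTEquiv F k).symm c).2
    have hz : ((degreeLTEquiv F k).symm c : F[X]) = 0 := by
      refine eq_zero_of_dvd_of_degree_lt (minpoly.dvd F P h0) ?_
      rwa [degree_eq_natDegree hirr.ne_zero, hdeg]
    simpa using hz
  obtain ⟨c, hc⟩ := LinearMap.injective_iff_surjective.1 hinj w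
  exact ⟨_, hc⟩

/-- If every nonzero vector of a finite module lies in exactly one member of a family of submodules
of cardinality `m`, this counts the family. -/
theorem Submodule.natCard_mul_of_existsUnique_mem {R M : Type*} [Semiring R] [AddCommMonoid M]
    [Module R M] [Finite M] {S : Set (Submodule R M)} {m : ℕ}
    (hcard : ∀ U ∈ S, Nat.card U = m) (hS : ∀ w : M, w ≠ 0 → ∃! U, U ∈ S ∧ w ∈ U) :
    Nat.card S * (m - 1) = Nat.card M - 1 := by
  classical
  have : Finite (Submodule R M) := Finite.of_injective _ SetLike.coe_injective
  have := Fintype.ofFinite M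
  have := Fintype.ofFinite S
  have hne {N : Type _} [Zero N] [Finite N] : Nat.card {x : N // x ≠ 0} = Nat.card N - 1 := by
    have := Fintype.ofFinite N
    simp [Nat.card_eq_fintype_card, Fintype.card_subtype_compl]
  let e : (Σ U : S, {x : U.1 // x ≠ 0}) → {w : M // w ≠ 0} :=
    fun x => ⟨x.2.1.1, fun h => x.2.2 (Subtype.ext h)⟩
  have he : Function.Bijective e := by
    constructor
    · rintro ⟨⟨U, hU⟩, ⟨x, hxU⟩, hx⟩ ⟨⟨V, hV⟩, ⟨y, hyV⟩, hy⟩ hxy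
      obtain rfl : x = y := congrArg Subtype.val hxy
      obtain rfl : U = V :=
        (hS x fun h => hx (Subtype.ext h)).unique ⟨hU, hxU⟩ ⟨hV, hyV⟩
      rfl
    · rintro ⟨w, hw⟩
      obtain ⟨U, ⟨hU, hwU⟩, -⟩ := hS w hw
      exact ⟨⟨⟨U, hU⟩, ⟨w, hwU⟩, fun h => hw (congrArg Subtype.val h)⟩, rfl⟩
  have hc := Nat.card_eq_of_bijective e he
  rw [Nat.card_sigma, hne] at hc
  rw [← hc, Finset.sum_congr rfl fun U _ => (hne (N := U.1)).trans (by rw [hcard U.1 U.2]),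
    Finset.sum_const, Finset.card_univ, Nat.card_eq_fintype_card, smul_eq_mul]


/-- The `(k, ks)`-spread code
`S = {rowsp(A_1 | ⋯ | A_s) : A_i ∈ F[P], (A_1, …, A_s) ≠ 0}` (where `P` is a `k × k`
matrix over the finite field `F` with `q` elements whose minimal polynomial is a monic
irreducible polynomial of degree `k`) has cardinality `(q^{ks} − 1)/(q^k − 1)`. -/
theorem spread_code_cardinality
    (F : Type*) [Field F] [Fintype F] [DecidableEq F] (k s : ℕ) (hs : 1 ≤ s)
    (p : Polynomial F) (hmonic : p.Monic) (hirr : Irreducible p) (hdeg : p.natDegree = k)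
    (P : Matrix (Fin k) (Fin k) F) (hmin : minpoly F P = p)
    (S : Set (Submodule F (Fin s × Fin k → F)))
    (hS : S = {U | ∃ A : Fin s → Matrix (Fin k) (Fin k) F,
      (∀ i, ∃ f : Polynomial F, Polynomial.aeval P f = A i) ∧ A ≠ 0 ∧
      U = LinearMap.range
        (Matrix.of fun (i : Fin k) (j : Fin s × Fin k) => A j.1 i j.2).vecMulLinear}) :
    Nat.card S = (Fintype.card F ^ (k * s) - 1) / (Fintype.card F ^ k - 1) := by
  subst hmin
  have hk : 0 < k := hdeg ▸ hirr.natDegree_pos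
  have hq : 1 < Fintype.card F := Fintype.one_lt_card
  have hvec (A : Fin s → Matrix (Fin k) (Fin k) F) (v : Fin k → F) (i : Fin s) (j : Fin k) :
      (Matrix.of fun (i : Fin k) (j : Fin s × Fin k) => A j.1 i j.2).vecMulLinear v (i, j) =
        Matrix.vecMul v (A i) j := rfl
  have hcard : ∀ U ∈ S, Nat.card U = Fintype.card F ^ k := by
    rw [hS]
    rintro U ⟨A, hA, hA0, rfl⟩
    obtain ⟨i, hi⟩ := Function.ne_iff.1 hA0
    obtain ⟨f, hf⟩ := hA i
    rw [← Nat.card_congr (LinearEquiv.ofInjective _ ?_).toEquiv]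
    · simp
    rw [← LinearMap.ker_eq_bot, LinearMap.ker_eq_bot']
    intro v hv
    by_contra hv0
    refine hi (hf ▸ aeval_eq_zero_of_vecMul_eq_zero hirr hv0 (hf ▸ funext fun j => ?_))
    rw [← hvec, hv]
    rfl
  have hle (A B : Fin s → Matrix (Fin k) (Fin k) F)
      (hA : ∀ i, ∃ f : Polynomial F, Polynomial.aeval P f = A i)
      (hB : ∀ i, ∃ f : Polynomial F, Polynomial.aeval P f = B i)
      (w : Fin s × Fin k → F) (hw : w ≠ 0)
      (hwA : w ∈ LinearMap.range
        (Matrix.of fun (i : Fin k) (j : Fin s × Fin k) => A j.1 i j.2).vecMulLinear)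
      (hwB : w ∈ LinearMap.range
        (Matrix.of fun (i : Fin k) (j : Fin s × Fin k) => B j.1 i j.2).vecMulLinear) :
      LinearMap.range
        (Matrix.of fun (i : Fin k) (j : Fin s × Fin k) => A j.1 i j.2).vecMulLinear ≤
      LinearMap.range
        (Matrix.of fun (i : Fin k) (j : Fin s × Fin k) => B j.1 i j.2).vecMulLinear := by
    obtain ⟨v, rfl⟩ := hwA
    obtain ⟨u, hu⟩ := hwB
    have hv : v ≠ 0 := by
      rintro rfl
      exact hw (map_zero _)
    obtain ⟨g, rfl⟩ := exists_vecMul_aeval_eq hirr hdeg hv u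
    have hAB (i : Fin s) : A i = Polynomial.aeval P g * B i := by
      obtain ⟨a, ha⟩ := hA i
      obtain ⟨b, hb⟩ := hB i
      have h0 : Matrix.vecMul v (Polynomial.aeval P (a - g * b)) = 0 := by
        rw [map_sub, map_mul, ha, hb, Matrix.vecMul_sub, ← Matrix.vecMul_vecMul, sub_eq_zero]
        funext j
        rw [← hvec, ← hvec, hu]
      have := aeval_eq_zero_of_vecMul_eq_zero hirr hv h0
      rwa [map_sub, map_mul, ha, hb, sub_eq_zero] at this
    rintro _ ⟨x, rfl⟩
    refine ⟨Matrix.vecMul x (Polynomial.aeval P g), funext fun ⟨i, j⟩ => ?_⟩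
    rw [hvec, hvec, hAB, Matrix.vecMul_vecMul]
  have huniq : ∀ w : Fin s × Fin k → F, w ≠ 0 → ∃! U, U ∈ S ∧ w ∈ U := by
    intro w hw
    obtain ⟨⟨i₀, j₀⟩, hij⟩ := Function.ne_iff.1 hw
    have hv : (fun j => w (i₀, j)) ≠ 0 := Function.ne_iff.2 ⟨j₀, hij⟩
    obtain ⟨A, hA, hwA⟩ : ∃ A : Fin s → Matrix (Fin k) (Fin k) F,
        (∀ i, ∃ f : Polynomial F, Polynomial.aeval P f = A i) ∧
          ∀ i, Matrix.vecMul (fun j => w (i₀, j)) (A i) = fun j => w (i, j) := by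
      choose f hf using fun i => exists_vecMul_aeval_eq hirr hdeg hv fun j => w (i, j)
      exact ⟨fun i => Polynomial.aeval P (f i), fun i => ⟨f i, rfl⟩, hf⟩
    have hA0 : A ≠ 0 := by
      rintro rfl
      exact hv (by rw [← hwA i₀, Pi.zero_apply, Matrix.vecMul_zero])
    have hmem : w ∈ LinearMap.range
        (Matrix.of fun (i : Fin k) (j : Fin s × Fin k) => A j.1 i j.2).vecMulLinear :=
      ⟨_, funext fun ⟨i, j⟩ => (hvec A _ i j).trans (congrFun (hwA i) j)⟩
    refine ⟨_, ⟨hS ▸ ⟨A, hA, hA0, rfl⟩, hmem⟩, ?_⟩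
    rintro V ⟨hV, hwV⟩
    rw [hS] at hV
    obtain ⟨B, hB, -, rfl⟩ := hV
    exact le_antisymm (hle B A hB hA w hw hwV hmem) (hle A B hA hB w hw hmem hwV)
  have hmain := Submodule.natCard_mul_of_existsUnique_mem hcard huniq
  have hM : Nat.card (Fin s × Fin k → F) = Fintype.card F ^ (k * s) := by
    simp [mul_comm]
  rw [← hM, ← hmain, Nat.mul_div_cancel _ (Nat.sub_pos_of_lt (Nat.one_lt_pow hk.ne' hq))]
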